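/- arXiv:1811.00676 — 2 statements merged into one kernel-verified Lean document; each statement's English description precedes it below -/
import Mathlib

section
/- Let T_j denote the j-th Chebyshev polynomial of the first kind and, for k a positive natural number, let (C_n^{(k)})_{n≥0} be the Gegenbauer polynomials with parameter k defined by their three-term recurrence. Then for all natural numbers j ≥ k ≥ 1, the k-th derivative of T_j satisfies d^k T_j / dx^k = 2^{k−1} j (k−1)! C_{j−k}^{(k)}. Consequently, differentiation of any order on Chebyshev expansions is represented in the appropriate Gegenbauer basis by a sparse (single-diagonal) operator. -/
/-- The Gegenbauer (ultraspherical) polynomials `C_n^{(λ)} ∈ ℝ[X]` for a positive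
natural parameter `l`, defined by `C₀ = 1`, `C₁ = 2λX`, and the recurrence
`C_{j+1} = (2(j+λ)/(j+1)) X C_j − ((j+2λ−1)/(j+1)) C_{j−1}` for `j ≥ 1`. -/
noncomputable def gegenbauer (l : ℕ) : ℕ → Polynomial ℝ
  | 0 => 1
  | 1 => Polynomial.C (2 * (l : ℝ)) * Polynomial.X
  | j + 2 =>
      Polynomial.C (2 * ((j + 1 : ℕ) + (l : ℝ)) / ((j + 1 : ℕ) + 1)) * Polynomial.X
          * gegenbauer l (j + 1)
        - Polynomial.C (((j + 1 : ℕ) + 2 * (l : ℝ) - 1) / ((j + 1 : ℕ) + 1))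
          * gegenbauer l j

open Polynomial in
theorem gegenbauer_recurrence (l n : ℕ) :
    ((n : ℝ[X]) + 2) * gegenbauer l (n + 2)
      = 2 * ((n : ℝ[X]) + 1 + (l : ℝ[X])) * X * gegenbauer l (n + 1)
        - ((n : ℝ[X]) + 2 * (l : ℝ[X])) * gegenbauer l n := by
  have h : ((n : ℝ) + 1 + 1) ≠ 0 := by positivity
  rw [gegenbauer]
  refine Polynomial.funext fun x => ?_
  simp only [eval_mul, eval_add, eval_sub, eval_C, eval_X, eval_natCast, eval_ofNat, eval_one]
  push_cast
  field_simp
  ring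

open Polynomial in
/-- The Gegenbauer polynomials of parameter `l` in the basis of parameter `l + 1`. -/
theorem gegenbauer_eq_sub (l : ℕ) (n : ℕ) :
    ((n : ℝ[X]) + 2 + l) * gegenbauer l (n + 2)
      = l * (gegenbauer (l + 1) (n + 2) - gegenbauer (l + 1) n) := by
  have two_ne (m : ℕ) : (m : ℝ[X]) + 2 ≠ 0 := by exact_mod_cast (by omega : m + 2 ≠ 0)
  have C_two_mul (m : ℕ) : (C (2 * (m : ℝ)) : ℝ[X]) = 2 * m := by
    rw [map_mul, map_natCast, map_ofNat]
  induction n using Nat.twoStepInduction with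
  | zero =>
    have hG := gegenbauer_recurrence l 0
    have hH := gegenbauer_recurrence (l + 1) 0
    simp only [zero_add, gegenbauer.eq_1, gegenbauer.eq_2, C_two_mul] at hG hH ⊢
    push_cast at hG hH ⊢
    apply mul_left_cancel₀ (two_ne 0)
    push_cast
    linear_combination (2 + (l : ℝ[X])) * hG - (l : ℝ[X]) * hH
  | one =>
    have hG := gegenbauer_recurrence l 0
    have hH := gegenbauer_recurrence (l + 1) 0
    have hG' := gegenbauer_recurrence l 1
    have hH' := gegenbauer_recurrence (l + 1) 1
    simp only [zero_add, Nat.reduceAdd, gegenbauer.eq_1, gegenbauer.eq_2, C_two_mul]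
      at hG hH hG' hH' ⊢
    push_cast at hG hH hG' hH' ⊢
    apply mul_left_cancel₀ (two_ne 0)
    apply mul_left_cancel₀ (two_ne 1)
    push_cast
    linear_combination 2 * (3 + (l : ℝ[X])) * hG' - 2 * (l : ℝ[X]) * hH'
      + 2 * (3 + (l : ℝ[X])) * (2 + l) * X * hG - 2 * (l : ℝ[X]) * (3 + l) * X * hH
  | more n ih ih' =>
    have hG := gegenbauer_recurrence l (n + 2)
    have hH := gegenbauer_recurrence (l + 1) (n + 2)
    have hH' := gegenbauer_recurrence (l + 1) n
    have hne : (n : ℝ[X]) + 2 + l ≠ 0 := by exact_mod_cast (by omega : n + 2 + l ≠ 0)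
    simp only [add_assoc, Nat.reduceAdd] at hG hH hH' ih ih' ⊢
    push_cast at hG hH hH' ih ih' ⊢
    apply mul_left_cancel₀ (two_ne (n + 2))
    apply mul_left_cancel₀ hne
    push_cast
    linear_combination ((n : ℝ[X]) + 2 + l) * (n + 4 + l) * hG
      - (l : ℝ[X]) * (n + 2 + l) * hH + (l : ℝ[X]) * (n + 4 + l) * hH'
      + 2 * ((n : ℝ[X]) + 2 + l) * (n + 4 + l) * X * ih'
      - ((n : ℝ[X]) + 4 + l) * (n + 2 + 2 * l) * ih

open Polynomial in
theorem derivative_gegenbauer_succ (l : ℕ) (n : ℕ) :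
    derivative (gegenbauer l (n + 1)) = 2 * (l : ℝ[X]) * gegenbauer (l + 1) n := by
  have two_ne (m : ℕ) : (m : ℝ[X]) + 2 ≠ 0 := by exact_mod_cast (by omega : m + 2 ≠ 0)
  have C_two_mul (m : ℕ) : (C (2 * (m : ℝ)) : ℝ[X]) = 2 * m := by
    rw [map_mul, map_natCast, map_ofNat]
  have hD (n : ℕ) := congrArg derivative (gegenbauer_recurrence l n)
  simp only [derivative_mul, derivative_sub, derivative_add, derivative_natCast,
    derivative_ofNat, derivative_one, derivative_X] at hD
  induction n using Nat.twoStepInduction with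
  | zero =>
    simp only [zero_add, gegenbauer.eq_1, gegenbauer.eq_2, C_two_mul, derivative_mul,
      derivative_natCast, derivative_ofNat, derivative_X]
    ring
  | one =>
    have hD' := hD 0
    simp only [zero_add, Nat.reduceAdd, gegenbauer.eq_1, gegenbauer.eq_2, C_two_mul] at hD' ⊢
    simp only [derivative_mul, derivative_natCast, derivative_ofNat, derivative_one,
      derivative_X] at hD'
    push_cast at hD' ⊢
    apply mul_left_cancel₀ (two_ne 0)
    push_cast
    linear_combination hD'
  | more n ih ih' =>
    have hD' := hD (n + 1)
    have hH := gegenbauer_recurrence (l + 1) n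
    have hS := gegenbauer_eq_sub l n
    simp only [add_assoc, Nat.reduceAdd] at hD' hH hS ih ih' ⊢
    push_cast at hD' hH hS ih ih' ⊢
    apply mul_left_cancel₀ (two_ne (n + 1))
    push_cast
    linear_combination hD' + 2 * hS - 2 * (l : ℝ[X]) * hH
      + 2 * ((n : ℝ[X]) + 2 + l) * X * ih' - ((n : ℝ[X]) + 1 + 2 * l) * ih

open Polynomial in
theorem gegenbauer_one (n : ℕ) : gegenbauer 1 n = Chebyshev.U ℝ n := by
  induction n using Nat.twoStepInduction with
  | zero => simp [gegenbauer]
  | one => simp [gegenbauer, map_ofNat]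
  | more n ih ih' =>
    have hG := gegenbauer_recurrence 1 n
    have two_ne : (n : ℝ[X]) + 2 ≠ 0 := by exact_mod_cast (by omega : n + 2 ≠ 0)
    rw [ih, ih'] at hG
    apply mul_left_cancel₀ two_ne
    push_cast at hG ⊢
    rw [Chebyshev.U_add_two]
    linear_combination hG

/-- **Chebyshev derivatives in the Gegenbauer basis.** For `j ≥ k ≥ 1`, the
`k`-th derivative of the Chebyshev polynomial of the first kind satisfies
`d^k T_j / dx^k = 2^{k−1} j (k−1)! C_{j−k}^{(k)}`, so differentiation of any
order is a single-diagonal (sparse) operator in the Gegenbauer basis. -/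
theorem chebyshevT_iterated_deriv_eq_gegenbauer (j k : ℕ) (hk : 1 ≤ k) (hjk : k ≤ j) :
    (Polynomial.derivative (R := ℝ))^[k] (Polynomial.Chebyshev.T ℝ j)
      = Polynomial.C ((2 : ℝ) ^ (k - 1) * (j : ℝ) * (Nat.factorial (k - 1) : ℝ))
          * gegenbauer k (j - k) := by
  obtain ⟨n, rfl⟩ := Nat.exists_eq_add_of_le hjk
  rw [Nat.add_sub_cancel_left]
  induction k, hk using Nat.le_induction generalizing n with
  | base =>
    rw [gegenbauer_one, Function.iterate_one, Polynomial.Chebyshev.T_derivative_eq_U]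
    simp
  | succ k hk ih =>
    obtain ⟨m, rfl⟩ := Nat.exists_eq_add_of_le' hk
    have h := ih (n + 1) (by omega)
    rw [show m + 1 + 1 + n = m + 1 + (n + 1) by omega, Function.iterate_succ_apply', h,
      Polynomial.derivative_C_mul, derivative_gegenbauer_succ]
    simp only [Nat.add_sub_cancel, Nat.factorial_succ, pow_succ, map_mul, map_pow,
      Nat.cast_mul, map_natCast, map_ofNat]
    ring
end

section
/- Let λ be a positive natural number and let (C_n^{(λ)})_{n≥0} be the Gegenbauer polynomials with parameter λ defined by their three-term recurrence. Then the Gegenbauer polynomials are orthogonal on [−1,1] with respect to the weight (1−x²)^{λ−1/2}: for all natural numbers m ≠ n, ∫_{−1}^{1} C_m^{(λ)}(x) C_n^{(λ)}(x) (1−x²)^{λ−1/2} dx = 0. -/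
open Polynomial in
/-- The two standard derivative relations, `(n+1) C_{n+1} = x D C_{n+1} - D C_n` and
`(n+2λ) C_n = D C_{n+1} - x D C_n`, where `D` is the derivative. -/
theorem gegenbauer_derivative_relations (l n : ℕ) :
    ((n : ℝ[X]) + 1) * gegenbauer l (n + 1)
        = X * derivative (gegenbauer l (n + 1)) - derivative (gegenbauer l n) ∧
      ((n : ℝ[X]) + 2 * (l : ℝ[X])) * gegenbauer l n
        = derivative (gegenbauer l (n + 1)) - X * derivative (gegenbauer l n) := by
  induction n with
  | zero => simp [gegenbauer, C_ofNat, mul_comm]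
  | succ n ih =>
    obtain ⟨hA, hB⟩ := ih
    have hrec : ((n : ℝ[X]) + 2) * gegenbauer l (n + 2)
        = 2 * ((n : ℝ[X]) + 1 + (l : ℝ[X])) * X * gegenbauer l (n + 1)
          - ((n : ℝ[X]) + 2 * (l : ℝ[X])) * gegenbauer l n := by
      have hn : ((n : ℝ) + 2) ≠ 0 := by positivity
      have h₁ : ((n : ℝ[X]) + 2) * C (2 * ((n + 1 : ℕ) + (l : ℝ)) / ((n + 1 : ℕ) + 1))
          = 2 * ((n : ℝ[X]) + 1 + (l : ℝ[X])) := by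
        have : ((n : ℝ) + 2) * (2 * ((n + 1 : ℕ) + (l : ℝ)) / ((n + 1 : ℕ) + 1))
            = 2 * (n + 1 + l) := by
          push_cast
          rw [show (n : ℝ) + 1 + 1 = n + 2 by ring]
          field_simp
        simpa only [C_mul, C_add, C_ofNat, C_1, map_natCast] using congrArg (C : ℝ →+* ℝ[X]) this
      have h₂ : ((n : ℝ[X]) + 2) * C (((n + 1 : ℕ) + 2 * (l : ℝ) - 1) / ((n + 1 : ℕ) + 1))
          = (n : ℝ[X]) + 2 * (l : ℝ[X]) := by
        have : ((n : ℝ) + 2) * (((n + 1 : ℕ) + 2 * (l : ℝ) - 1) / ((n + 1 : ℕ) + 1))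
            = n + 2 * l := by
          push_cast
          rw [show (n : ℝ) + 1 + 1 = n + 2 by ring]
          field_simp
          ring
        simpa only [C_mul, C_add, C_ofNat, C_1, map_natCast] using congrArg (C : ℝ →+* ℝ[X]) this
      rw [gegenbauer]
      linear_combination X * gegenbauer l (n + 1) * h₁ - gegenbauer l n * h₂
    have hn : ((n : ℝ[X]) + 2) ≠ 0 := by exact_mod_cast (by omega : n + 2 ≠ 0)
    have hrec' := congrArg derivative hrec
    simp only [derivative_mul, derivative_add, derivative_sub, derivative_natCast,
      derivative_ofNat, derivative_one, derivative_X] at hrec'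
    have hB' : ((n : ℝ[X]) + 1 + 2 * (l : ℝ[X])) * gegenbauer l (n + 1)
        = derivative (gegenbauer l (n + 2)) - X * derivative (gegenbauer l (n + 1)) := by
      apply mul_left_cancel₀ hn
      linear_combination -hrec' + ((n : ℝ[X]) + 2 * (l : ℝ[X])) * hA
    push_cast
    refine ⟨?_, hB'⟩
    linear_combination hrec + X * hB' + X * hA - hB

open Polynomial in
/-- The Gegenbauer differential equation
`(1 - x²) D² C_n - (2λ+1) x D C_n + n (n+2λ) C_n = 0`, where `D` is the derivative. -/
theorem gegenbauer_differential_equation (l n : ℕ) :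
    (1 - X ^ 2) * derivative (derivative (gegenbauer l n))
      - (2 * (l : ℝ[X]) + 1) * X * derivative (gegenbauer l n)
      + (n : ℝ[X]) * ((n : ℝ[X]) + 2 * (l : ℝ[X])) * gegenbauer l n = 0 := by
  cases n with
  | zero => simp [gegenbauer]
  | succ n =>
    obtain ⟨hA, hB⟩ := gegenbauer_derivative_relations l n
    have hA' := congrArg derivative hA
    have hB' := congrArg derivative hB
    simp only [derivative_mul, derivative_add, derivative_sub, derivative_natCast,
      derivative_ofNat, derivative_one, derivative_X] at hA' hB'
    push_cast
    linear_combination X * hA' - hB' + ((n : ℝ[X]) + 2 * (l : ℝ[X]) + 1) * hA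

open Polynomial in
/-- Derivative of the weighted Wronskian of two Gegenbauer polynomials. -/
theorem hasDerivAt_gegenbauer_wronskian {l : ℕ} (hl : 0 < l) (m n : ℕ) {x : ℝ}
    (hx : x ∈ Set.Icc (-1 : ℝ) 1) :
    HasDerivAt
      (fun y : ℝ => (1 - y ^ 2) ^ ((l : ℝ) + 1 / 2)
        * (derivative (gegenbauer l n) * gegenbauer l m
            - derivative (gegenbauer l m) * gegenbauer l n).eval y)
      (((m : ℝ) - n) * (m + n + 2 * l)
        * ((gegenbauer l m).eval x * (gegenbauer l n).eval x
          * (1 - x ^ 2) ^ ((l : ℝ) - 1 / 2))) x := by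
  have hl' : (1 : ℝ) ≤ l := by exact_mod_cast hl
  have hbase : HasDerivAt (fun y : ℝ => 1 - y ^ 2) (-(2 * x)) x := by
    simpa using (hasDerivAt_pow 2 x).const_sub 1
  have hweight := hbase.rpow_const (p := (l : ℝ) + 1 / 2) (Or.inr (by linarith))
  have hpow : (1 - x ^ 2) ^ ((l : ℝ) + 1 / 2)
      = (1 - x ^ 2) * (1 - x ^ 2) ^ ((l : ℝ) - 1 / 2) := by
    rw [← Real.rpow_one_add' (by nlinarith [hx.1, hx.2]) (by linarith)]
    congr 1
    ring
  have hODE (k : ℕ) := congrArg (eval x) (gegenbauer_differential_equation l k)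
  have hm := hODE m
  have hn := hODE n
  simp only [eval_add, eval_sub, eval_mul, eval_pow, eval_X, eval_one, eval_natCast,
    eval_ofNat, eval_zero] at hm hn
  refine (hweight.mul (Polynomial.hasDerivAt _ x)).congr_deriv ?_
  rw [hpow, show (l : ℝ) + 1 / 2 - 1 = l - 1 / 2 by ring]
  simp only [derivative_sub, derivative_mul, eval_add, eval_sub, eval_mul]
  linear_combination (1 - x ^ 2) ^ ((l : ℝ) - 1 / 2)
    * ((gegenbauer l m).eval x * hn - (gegenbauer l n).eval x * hm)

/-- **Orthogonality of the Gegenbauer polynomials.** For `λ ≥ 1` and `m ≠ n`,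
`∫_{−1}^{1} C_m^{(λ)}(x) C_n^{(λ)}(x) (1−x²)^{λ−1/2} dx = 0`. -/
theorem gegenbauer_orthogonal (l : ℕ) (hl : 0 < l) (m n : ℕ) (hmn : m ≠ n) :
    ∫ x in (-1 : ℝ)..1,
      (gegenbauer l m).eval x * (gegenbauer l n).eval x
        * (1 - x ^ 2) ^ ((l : ℝ) - 1 / 2) = 0 := by
  have hl' : (1 : ℝ) ≤ l := by exact_mod_cast hl
  have hcont : Continuous fun x : ℝ => ((m : ℝ) - n) * (m + n + 2 * l)
      * ((gegenbauer l m).eval x * (gegenbauer l n).eval x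
        * (1 - x ^ 2) ^ ((l : ℝ) - 1 / 2)) := by
    have : Continuous fun x : ℝ => (1 - x ^ 2) ^ ((l : ℝ) - 1 / 2) :=
      (by fun_prop : Continuous fun x : ℝ => 1 - x ^ 2).rpow_const
        fun _ => Or.inr (by linarith)
    fun_prop
  have hint := intervalIntegral.integral_eq_sub_of_hasDerivAt
    (fun x hx => hasDerivAt_gegenbauer_wronskian hl m n
      (by rwa [Set.uIcc_of_le (by norm_num)] at hx))
    (hcont.intervalIntegrable (-1) 1)
  have hexp : (l : ℝ) + 1 / 2 ≠ 0 := by positivity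
  have hzero : (0 : ℝ) ^ ((l : ℝ) + 1 / 2) = 0 := Real.zero_rpow hexp
  rw [intervalIntegral.integral_const_mul] at hint
  simp only [even_two, Even.neg_pow, one_pow, sub_self, hzero, zero_mul] at hint
  have hne : ((m : ℝ) - n) * (m + n + 2 * l) ≠ 0 :=
    mul_ne_zero (sub_ne_zero.mpr (by exact_mod_cast hmn)) (by positivity)
  exact (mul_eq_zero.mp hint).resolve_left hne
end
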